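/- arXiv:1406.5577 — 3 statements merged into one kernel-verified Lean document; each statement's English description precedes it below -/
import Mathlib

section
/- Let μ be a determinantal point process over 𝒴 = Fin N with real symmetric kernel K satisfying 0 ≺ K ≺ I, and let A and B be disjoint subsets of 𝒴. Then the events (A ∩ Y = ∅) and (B ∩ Y = ∅) are independent, i.e. Pr(A ∩ Y = ∅ and B ∩ Y = ∅) = Pr(A ∩ Y = ∅)·Pr(B ∩ Y = ∅), if and only if K_{A,B} = 0. -/
open Matrix BigOperators

/-- The submatrix of `K` with rows indexed by `A` and columns indexed by `B`. -/
def subm {N : ℕ} (K : Matrix (Fin N) (Fin N) ℝ) (A B : Finset (Fin N)) :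
    Matrix A B ℝ := fun i j => K i.1 j.1

open scoped Classical in
/-- The probability of the event `E` under the measure `μ`. -/
noncomputable def pr {N : ℕ} (μ : Finset (Fin N) → ℝ) (E : Finset (Fin N) → Prop) : ℝ :=
  ∑ S : Finset (Fin N), if E S then μ S else 0

/-- `μ` is a determinantal point process with kernel `K`. -/
noncomputable def IsDPP {N : ℕ} (μ : Finset (Fin N) → ℝ)
    (K : Matrix (Fin N) (Fin N) ℝ) : Prop :=
  (∀ S, 0 ≤ μ S) ∧ (∑ S : Finset (Fin N), μ S = 1) ∧
  ∀ A : Finset (Fin N), pr μ (fun S => A ⊆ S) = (subm K A A).det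

open scoped ComplexOrder MatrixOrder in
theorem Matrix.PosDef.exists_isUnit_eq_conjTranspose_mul_self {n : Type*} [Fintype n]
    [DecidableEq n] {M : Matrix n n ℝ} (hM : M.PosDef) :
    ∃ E : Matrix n n ℝ, IsUnit E ∧ M = Eᴴ * E := by
  obtain ⟨E, hE⟩ := CStarAlgebra.nonneg_iff_eq_star_mul_self.mp hM.posSemidef.nonneg
  rw [star_eq_conjTranspose] at hE
  refine ⟨E, ?_, hE⟩
  have h := hM.isUnit
  rw [hE, isUnit_iff_isUnit_det, det_mul, IsUnit.mul_iff] at h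
  exact (isUnit_iff_isUnit_det _).2 h.2

theorem Finset.one_add_sum_le_prod_one_add {ι : Type*} (s : Finset ι) (f : ι → ℝ)
    (hf : ∀ i ∈ s, 0 ≤ f i) : 1 + ∑ i ∈ s, f i ≤ ∏ i ∈ s, (1 + f i) := by
  classical
  induction s using Finset.induction_on with
  | empty => simp
  | insert a s ha ih =>
    rw [Finset.sum_insert ha, Finset.prod_insert ha]
    have h₁ := ih fun i hi => hf i (Finset.mem_insert_of_mem hi)
    have h₂ := hf a (Finset.mem_insert_self a s)
    have h₃ : 0 ≤ ∑ i ∈ s, f i :=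
      Finset.sum_nonneg fun i hi => hf i (Finset.mem_insert_of_mem hi)
    nlinarith

theorem Matrix.PosSemidef.one_add_trace_le_det_one_add {n : Type*} [Fintype n]
    [DecidableEq n] {Q : Matrix n n ℝ} (hQ : Q.PosSemidef) : 1 + Q.trace ≤ (1 + Q).det := by
  have hdet : (1 + Q).det = ∏ i, (1 + hQ.1.eigenvalues i) := by
    have h := congrArg (Polynomial.eval (-1)) hQ.1.charpoly_eq
    rw [eval_charpoly, Polynomial.eval_prod] at h
    have hneg : scalar n (-1 : ℝ) - Q = -(1 + Q) := by
      rw [map_neg, map_one]; abel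
    rw [hneg, det_neg] at h
    have hprod : ∏ i, Polynomial.eval (-1) (Polynomial.X - Polynomial.C (hQ.1.eigenvalues i))
        = (-1) ^ Fintype.card n * ∏ i, (1 + hQ.1.eigenvalues i) := by
      rw [← Finset.card_univ, ← Finset.prod_const, ← Finset.prod_mul_distrib]
      refine Finset.prod_congr rfl fun i _ => ?_
      simp only [Polynomial.eval_sub, Polynomial.eval_X, Polynomial.eval_C]
      ring
    exact mul_left_cancel₀ (pow_ne_zero _ (by norm_num)) (h.trans hprod)
  have htr : Q.trace = ∑ i, hQ.1.eigenvalues i := by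
    simpa using hQ.1.trace_eq_sum_eigenvalues
  rw [hdet, htr]
  exact Finset.one_add_sum_le_prod_one_add _ _ fun i _ => hQ.eigenvalues_nonneg i

/-- The equality case of Fischer's inequality. -/
theorem Matrix.PosDef.eq_zero_of_det_fromBlocks_eq {m n : Type*} [Fintype m] [Fintype n]
    [DecidableEq m] [DecidableEq n] {A : Matrix m m ℝ} {B : Matrix m n ℝ} {D : Matrix n n ℝ}
    (hM : (fromBlocks A B Bᴴ D).PosDef)
    (hdet : (fromBlocks A B Bᴴ D).det = A.det * D.det) : B = 0 := by
  have hA : A.PosDef := hM.submatrix Sum.inl_injective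
  have := hA.isUnit.invertible
  have hC : (D - Bᴴ * A⁻¹ * B).PosDef := by
    refine ((hA.fromBlocks₁₁ B D).1 hM.posSemidef).posDef_iff_det_ne_zero.2 ?_
    have h := hM.det_pos
    rw [det_fromBlocks₁₁, invOf_eq_nonsing_inv] at h
    exact right_ne_zero_of_mul h.ne'
  obtain ⟨E, hE, hAE⟩ := hA.inv.exists_isUnit_eq_conjTranspose_mul_self
  obtain ⟨F, hF, hCF⟩ := hC.inv.exists_isUnit_eq_conjTranspose_mul_self
  set C := D - Bᴴ * A⁻¹ * B with hCdef
  have hD : D = C + (E * B)ᴴ * (E * B) := by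
    rw [hCdef, hAE, conjTranspose_mul]
    simp only [Matrix.mul_assoc, sub_add_cancel]
  have hQ : E * B * C⁻¹ * (E * B)ᴴ = (F * (E * B)ᴴ)ᴴ * (F * (E * B)ᴴ) := by
    rw [hCF, conjTranspose_mul F, conjTranspose_conjTranspose]
    simp only [Matrix.mul_assoc]
  have hone : (1 + E * B * C⁻¹ * (E * B)ᴴ).det = 1 := by
    rw [det_fromBlocks₁₁, invOf_eq_nonsing_inv, ← hCdef] at hdet
    have h := mul_left_cancel₀ hA.det_pos.ne' hdet
    rw [hD, det_add_mul _ _ ((isUnit_iff_isUnit_det C).1 hC.isUnit)] at h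
    exact mul_left_cancel₀ hC.det_pos.ne' (h.symm.trans (mul_one _).symm)
  rw [hQ] at hone
  have hpsd := posSemidef_conjTranspose_mul_self (F * (E * B)ᴴ)
  have htr : ((F * (E * B)ᴴ)ᴴ * (F * (E * B)ᴴ)).trace = 0 :=
    le_antisymm (by linarith [hpsd.one_add_trace_le_det_one_add]) hpsd.trace_nonneg
  have hFEB := trace_conjTranspose_mul_self_eq_zero_iff.1 htr
  have hEB : (E * B)ᴴ = 0 := by
    rw [← nonsing_inv_mul_cancel_left F (E * B)ᴴ ((isUnit_iff_isUnit_det F).1 hF), hFEB,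
      Matrix.mul_zero]
  rw [conjTranspose_eq_zero] at hEB
  rw [← nonsing_inv_mul_cancel_left E B ((isUnit_iff_isUnit_det E).1 hE), hEB, Matrix.mul_zero]

theorem Matrix.PosDef.det_fromBlocks_eq_mul_iff {m n : Type*} [Fintype m] [Fintype n]
    [DecidableEq m] [DecidableEq n] {A : Matrix m m ℝ} {B : Matrix m n ℝ} {D : Matrix n n ℝ}
    (hM : (fromBlocks A B Bᴴ D).PosDef) :
    (fromBlocks A B Bᴴ D).det = A.det * D.det ↔ B = 0 := by
  refine ⟨hM.eq_zero_of_det_fromBlocks_eq, ?_⟩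
  rintro rfl
  rw [det_fromBlocks_zero₁₂]

theorem Matrix.det_one_sub_eq_sum_principal_minors {n R : Type*} [Fintype n] [DecidableEq n]
    [CommRing R] (M : Matrix n n R) :
    (1 - M).det = ∑ s : Finset n, (-1) ^ s.card *
      (M.submatrix ((↑) : s → n) ((↑) : s → n)).det := by
  have h : (1 - M).det = ∑ s : Finset n,
      det (Matrix.of (s.piecewise (-M).row (1 : Matrix n n R).row)) := by
    rw [sub_eq_neg_add]
    exact (detRowAlternating : (n → R) [⋀^n]→ₗ[R] R).toMultilinearMap.map_add_univ _ _
  rw [h]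
  refine Finset.sum_congr rfl fun s _ => ?_
  rw [det_piecewise_one_eq_submatrix_det, submatrix_neg, Pi.neg_apply, Pi.neg_apply, det_neg,
    Fintype.card_coe]

theorem Finset.sum_powerset_neg_one_pow_card_subset {α : Type*} [DecidableEq α]
    (A S : Finset α) :
    ∑ T ∈ A.powerset, (-1 : ℝ) ^ T.card * (if T ⊆ S then 1 else 0)
      = if A ∩ S = ∅ then 1 else 0 := by
  have h := congrArg (Int.cast : ℤ → ℝ) (Finset.sum_powerset_neg_one_pow_card (x := A ∩ S))
  push_cast at h
  rw [← h]
  simp only [mul_ite, mul_one, mul_zero]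
  rw [← Finset.sum_filter]
  refine Finset.sum_congr ?_ fun _ _ => rfl
  ext T
  simp only [Finset.mem_filter, Finset.mem_powerset, Finset.subset_inter_iff]

theorem pr_inter_eq_empty {N : ℕ} (μ : Finset (Fin N) → ℝ) (A : Finset (Fin N)) :
    pr μ (fun S => A ∩ S = ∅)
      = ∑ T ∈ A.powerset, (-1) ^ T.card * pr μ (fun S => T ⊆ S) := by
  simp only [pr, Finset.mul_sum]
  rw [Finset.sum_comm]
  refine Finset.sum_congr rfl fun S _ => ?_
  have h := congrArg (· * μ S) (Finset.sum_powerset_neg_one_pow_card_subset A S)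
  simp only [Finset.sum_mul, mul_assoc, ite_mul, one_mul, zero_mul] at h
  convert h.symm

theorem IsDPP.pr_inter_eq_empty {N : ℕ} {μ : Finset (Fin N) → ℝ}
    {K : Matrix (Fin N) (Fin N) ℝ} (hμ : IsDPP μ K) (A : Finset (Fin N)) :
    pr μ (fun S => A ∩ S = ∅) = (subm (1 - K) A A).det := by
  have hsub : subm (1 - K) A A = 1 - subm K A A := by
    ext i j
    simp only [subm, Matrix.sub_apply, one_apply, Subtype.ext_iff]
  rw [_root_.pr_inter_eq_empty, hsub, det_one_sub_eq_sum_principal_minors]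
  symm
  refine Finset.sum_bij (fun s _ => s.map (Function.Embedding.subtype (· ∈ A))) ?_ ?_ ?_ ?_
  · intro s _
    rw [Finset.mem_powerset]
    exact fun x hx => Finset.property_of_mem_map_subtype s hx
  · intro s _ t _ h
    exact Finset.map_injective _ h
  · intro T hT
    exact ⟨T.subtype (· ∈ A), Finset.mem_univ _,
      Finset.subtype_map_of_mem (Finset.mem_powerset.1 hT)⟩
  · intro s _
    rw [hμ.2.2, Finset.card_map,
      ← det_submatrix_equiv_self (s.equivMap (Function.Embedding.subtype (· ∈ A)))]
    rfl

/-- For a DPP with kernel `0 ≺ K ≺ I` and disjoint `A`, `B`, the events `A ∩ Y = ∅` and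
`B ∩ Y = ∅` are independent iff `K_{A,B} = 0`. -/
theorem dpp_avoid_independent_iff {N : ℕ} (μ : Finset (Fin N) → ℝ)
    (K : Matrix (Fin N) (Fin N) ℝ) (hμ : IsDPP μ K) (hsymm : K.IsSymm)
    (hK : K.PosDef) (hKI : (1 - K).PosDef)
    (A B : Finset (Fin N)) (hAB : Disjoint A B) :
    pr μ (fun S => A ∩ S = ∅ ∧ B ∩ S = ∅)
      = pr μ (fun S => A ∩ S = ∅) * pr μ (fun S => B ∩ S = ∅)
    ↔ subm K A B = 0 := by
  have hevent : (fun S => A ∩ S = ∅ ∧ B ∩ S = ∅) = fun S => A.disjUnion B hAB ∩ S = ∅ := by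
    funext S
    rw [Finset.disjUnion_eq_union, Finset.union_inter_distrib_right, Finset.union_eq_empty]
  have hoff : subm (1 - K) A B = -subm K A B := by
    ext i j
    have hij : i.1 ≠ j.1 := fun h => Finset.disjoint_left.1 hAB i.2 (h ▸ j.2)
    simp [subm, one_apply_ne hij]
  have hblocks : (subm (1 - K) (A.disjUnion B hAB) (A.disjUnion B hAB)).submatrix
        (Equiv.Finset.disjUnionEquiv A B hAB) (Equiv.Finset.disjUnionEquiv A B hAB)
      = fromBlocks (subm (1 - K) A A) (subm (1 - K) A B) (subm (1 - K) A B)ᴴ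
          (subm (1 - K) B B) := by
    ext (i | i) (j | j)
    · rfl
    · rfl
    · exact (hKI.1.apply _ _).symm
    · rfl
  have hpd : (fromBlocks (subm (1 - K) A A) (subm (1 - K) A B) (subm (1 - K) A B)ᴴ
      (subm (1 - K) B B)).PosDef := by
    rw [← hblocks]
    exact (hKI.submatrix Subtype.val_injective).submatrix (Equiv.injective _)
  rw [hevent, hμ.pr_inter_eq_empty, hμ.pr_inter_eq_empty, hμ.pr_inter_eq_empty,
    ← det_submatrix_equiv_self (Equiv.Finset.disjUnionEquiv A B hAB), hblocks,
    hpd.det_fromBlocks_eq_mul_iff, hoff, neg_eq_zero]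
end

section
/- Let μ be a determinantal point process over 𝒴 = Fin N with real symmetric kernel K satisfying 0 ≺ K ≺ I, and let A, B, C be disjoint subsets of 𝒴 with C nonempty. Then the events (A ⊆ Y) and (B ⊆ Y) are conditionally independent given (C ⊆ Y) — i.e. Pr(A ⊆ Y and B ⊆ Y and C ⊆ Y)·Pr(C ⊆ Y) = Pr(A ⊆ Y and C ⊆ Y)·Pr(B ⊆ Y and C ⊆ Y) — if and only if K^C_{A,B} = 0, i.e. K_{A,B} = K_{A,C} K_C⁻¹ K_{C,B}. -/
open Matrix BigOperators

/-- The `A × B` block of the Schur complement `K^C = K_{Cᶜ} - K_{Cᶜ,C} K_C⁻¹ K_{C,Cᶜ}`,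
i.e. `K_{A,B} - K_{A,C} K_C⁻¹ K_{C,B}` (for `A`, `B` disjoint from `C`). -/
noncomputable def schurBlock {N : ℕ} (K : Matrix (Fin N) (Fin N) ℝ)
    (C A B : Finset (Fin N)) : Matrix A B ℝ :=
  subm K A B - subm K A C * (subm K C C)⁻¹ * subm K C B

namespace Finset

theorem one_add_sum_le_prod_one_add_s10 {ι : Type*} (s : Finset ι) {f : ι → ℝ}
    (hf : ∀ i, 0 ≤ f i) : 1 + ∑ i ∈ s, f i ≤ ∏ i ∈ s, (1 + f i) := by
  classical
  induction s using Finset.induction_on with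
  | empty => simp
  | insert a s ha ih =>
    rw [sum_insert ha, prod_insert ha]
    nlinarith [hf a, mul_nonneg (hf a) (sum_nonneg fun i (_ : i ∈ s) => hf i)]

end Finset

namespace Matrix

variable {m n : Type*} [Fintype m] [DecidableEq m] [Fintype n] [DecidableEq n]

open scoped MatrixOrder Matrix.Norms.L2Operator in
theorem PosSemidef.exists_eq_conjTranspose_mul_self {W : Matrix n n ℝ} (hW : W.PosSemidef) :
    ∃ L : Matrix n n ℝ, W = Lᴴ * L :=
  CStarAlgebra.nonneg_iff_eq_star_mul_self.mp hW.nonneg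

theorem IsHermitian.det_one_add_eq_prod {W : Matrix n n ℝ} (hW : W.IsHermitian) :
    (1 + W).det = ∏ i, (1 + hW.eigenvalues i) := by
  have h := eval_charpoly W (-1)
  have hneg : scalar n (-1 : ℝ) - W = -(1 + W) := by
    rw [map_neg, map_one]; abel
  rw [hneg, det_neg, hW.charpoly_eq, Polynomial.eval_prod] at h
  have hfac : ∀ i, Polynomial.eval (-1 : ℝ)
      (Polynomial.X - Polynomial.C ((hW.eigenvalues i : ℝ) : ℝ)) =
        (-1) * (1 + hW.eigenvalues i) := by
    intro i; simp; ring
  simp only [RCLike.ofReal_real_eq_id, id, hfac, Finset.prod_mul_distrib, Finset.prod_const,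
    Finset.card_univ] at h
  exact (mul_left_cancel₀ (pow_ne_zero _ (by norm_num)) h).symm

theorem PosSemidef.eq_zero_of_det_one_add_eq_one {W : Matrix n n ℝ} (hW : W.PosSemidef)
    (h : (1 + W).det = 1) : W = 0 := by
  have hsum := Finset.one_add_sum_le_prod_one_add_s10 Finset.univ hW.eigenvalues_nonneg
  rw [← hW.1.det_one_add_eq_prod, h] at hsum
  have htr : W.trace = ∑ i, hW.1.eigenvalues i := hW.1.trace_eq_sum_eigenvalues
  exact hW.trace_eq_zero_iff.mp (le_antisymm (by linarith) hW.trace_nonneg)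

theorem PosDef.eq_zero_of_mul_mul_conjTranspose_eq_zero {k : Type*} {P : Matrix n n ℝ}
    (hP : P.PosDef) {Z : Matrix k n ℝ} (h : Z * P * Zᴴ = 0) : Z = 0 := by
  obtain ⟨L, hL⟩ := hP.posSemidef.exists_eq_conjTranspose_mul_self
  have hZ : Z * Lᴴ = 0 := by
    rw [← self_mul_conjTranspose_eq_zero, ← h, hL]
    simp [Matrix.mul_assoc]
  have hZP : Z * P = 0 := by rw [hL, ← Matrix.mul_assoc, hZ, Matrix.zero_mul]
  have hu : IsUnit P.det := (isUnit_iff_isUnit_det P).mp hP.isUnit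
  rw [← mul_nonsing_inv_cancel_right P Z hu, hZP, Matrix.zero_mul]

/-- Adding a positive semidefinite matrix `X P Xᴴ` to a positive definite matrix `D` preserves the
determinant only if the perturbation is trivial. -/
theorem PosDef.eq_zero_of_det_add_eq_det {D : Matrix m m ℝ} {P : Matrix n n ℝ} (hD : D.PosDef)
    (hP : P.PosDef) {X : Matrix m n ℝ} (h : (D + X * P * Xᴴ).det = D.det) : X = 0 := by
  obtain ⟨M, hM⟩ := hD.inv.posSemidef.exists_eq_conjTranspose_mul_self
  have hDu : IsUnit D.det := (isUnit_iff_isUnit_det D).mp hD.isUnit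
  have hfac : D + X * P * Xᴴ = D * (1 + Mᴴ * (M * X * P * Xᴴ)) := by
    have : Mᴴ * (M * X * P * Xᴴ) = D⁻¹ * (X * P * Xᴴ) := by
      rw [hM]; simp only [Matrix.mul_assoc]
    rw [this, Matrix.mul_add, Matrix.mul_one, mul_nonsing_inv_cancel_left _ _ hDu]
  have hW : M * X * P * Xᴴ * Mᴴ = (M * X) * P * (M * X)ᴴ := by
    simp only [conjTranspose_mul, Matrix.mul_assoc]
  rw [hfac, det_mul, det_one_add_mul_comm, hW] at h
  have hone := mul_left_cancel₀ hDu.ne_zero (h.trans (mul_one _).symm)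
  have hMX : M * X = 0 := hP.eq_zero_of_mul_mul_conjTranspose_eq_zero
    ((hP.posSemidef.mul_mul_conjTranspose_same (M * X)).eq_zero_of_det_one_add_eq_one hone)
  have hDX : D⁻¹ * X = 0 := by rw [hM, Matrix.mul_assoc, hMX, Matrix.mul_zero]
  rw [← mul_nonsing_inv_cancel_left D X hDu, hDX, Matrix.mul_zero]

theorem PosDef.schur_complement₁₁ {P : Matrix m m ℝ} {X : Matrix m n ℝ} {Q : Matrix n n ℝ}
    (h : (fromBlocks P X Xᴴ Q).PosDef) : (Q - Xᴴ * P⁻¹ * X).PosDef := by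
  have hP : P.PosDef := h.submatrix (e := Sum.inl) Sum.inl_injective
  have := hP.isUnit.invertible
  refine ((PosDef.fromBlocks₁₁ X Q hP).mp h.posSemidef).posDef_iff_det_ne_zero.mpr fun h0 => ?_
  have hdet := h.det_pos
  rw [det_fromBlocks₁₁, invOf_eq_nonsing_inv, h0, mul_zero] at hdet
  exact hdet.false

/-- The equality case of **Fischer's inequality**. -/
theorem PosDef.det_fromBlocks_eq_mul_iff_s10 {P : Matrix m m ℝ} {X : Matrix m n ℝ}
    {Q : Matrix n n ℝ} (h : (fromBlocks P X Xᴴ Q).PosDef) :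
    (fromBlocks P X Xᴴ Q).det = P.det * Q.det ↔ X = 0 := by
  have hP : P.PosDef := h.submatrix (e := Sum.inl) Sum.inl_injective
  refine ⟨fun hdet => ?_, fun hX => by simp [hX]⟩
  have := hP.isUnit.invertible
  rw [det_fromBlocks₁₁, invOf_eq_nonsing_inv] at hdet
  have hQ := mul_left_cancel₀ hP.det_pos.ne' hdet
  have := h.schur_complement₁₁.eq_zero_of_det_add_eq_det hP.inv (X := Xᴴ) <| by
    rw [hQ, conjTranspose_conjTranspose, sub_add_cancel]
  rwa [conjTranspose_eq_zero] at this

end Matrix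

theorem subm_union {N : ℕ} (K : Matrix (Fin N) (Fin N) ℝ) {A B : Finset (Fin N)}
    (hAB : Disjoint A B) :
    (subm K (A ∪ B) (A ∪ B)).submatrix (Equiv.Finset.union A B hAB) (Equiv.Finset.union A B hAB) =
      fromBlocks (subm K A A) (subm K A B) (subm K B A) (subm K B B) := by
  ext (i | i) (j | j) <;> rfl

theorem det_subm_union {N : ℕ} (K : Matrix (Fin N) (Fin N) ℝ) {A B : Finset (Fin N)}
    (hAB : Disjoint A B) :
    (subm K (A ∪ B) (A ∪ B)).det =
      (fromBlocks (subm K A A) (subm K A B) (subm K B A) (subm K B B)).det := by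
  rw [← subm_union K hAB, det_submatrix_equiv_self]

theorem Matrix.PosDef.subm {N : ℕ} {K : Matrix (Fin N) (Fin N) ℝ} (hK : K.PosDef)
    (A : Finset (Fin N)) : (subm K A A).PosDef :=
  hK.submatrix Subtype.val_injective

theorem conjTranspose_subm {N : ℕ} {K : Matrix (Fin N) (Fin N) ℝ} (hK : K.IsHermitian)
    (A B : Finset (Fin N)) : (subm K A B)ᴴ = subm K B A := by
  ext i j
  exact hK.apply i.1 j.1

theorem det_subm_union_eq_mul_schurBlock {N : ℕ} {K : Matrix (Fin N) (Fin N) ℝ} (hK : K.PosDef)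
    {A C : Finset (Fin N)} (hAC : Disjoint A C) :
    (subm K (A ∪ C) (A ∪ C)).det = (subm K C C).det * (schurBlock K C A A).det := by
  have := (hK.subm C).isUnit.invertible
  rw [det_subm_union K hAC, det_fromBlocks₂₂, invOf_eq_nonsing_inv, schurBlock]

theorem Matrix.PosDef.schurBlock {N : ℕ} {K : Matrix (Fin N) (Fin N) ℝ} (hK : K.PosDef)
    {A C : Finset (Fin N)} (hAC : Disjoint A C) : (schurBlock K C A A).PosDef := by
  have h := (hK.subm (C ∪ A)).submatrix (Equiv.Finset.union C A hAC.symm).injective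
  rw [subm_union K hAC.symm, ← conjTranspose_subm hK.1 C A] at h
  have h' := h.schur_complement₁₁
  rwa [conjTranspose_subm hK.1] at h'

theorem schurBlock_union {N : ℕ} (K : Matrix (Fin N) (Fin N) ℝ) {A B : Finset (Fin N)}
    (C : Finset (Fin N)) (hAB : Disjoint A B) :
    (schurBlock K C (A ∪ B) (A ∪ B)).submatrix
        (Equiv.Finset.union A B hAB) (Equiv.Finset.union A B hAB) =
      fromBlocks (schurBlock K C A A) (schurBlock K C A B)
        (schurBlock K C B A) (schurBlock K C B B) := by
  ext (i | i) (j | j) <;> rfl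

theorem conjTranspose_schurBlock {N : ℕ} {K : Matrix (Fin N) (Fin N) ℝ} (hK : K.IsHermitian)
    (A B C : Finset (Fin N)) : (schurBlock K C A B)ᴴ = schurBlock K C B A := by
  simp only [schurBlock, conjTranspose_sub, conjTranspose_mul, conjTranspose_nonsing_inv,
    conjTranspose_subm hK, Matrix.mul_assoc]

theorem det_schurBlock_union_eq_mul_iff {N : ℕ} {K : Matrix (Fin N) (Fin N) ℝ} (hK : K.PosDef)
    {A B C : Finset (Fin N)} (hAB : Disjoint A B) (hAC : Disjoint A C) (hBC : Disjoint B C) :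
    (schurBlock K C (A ∪ B) (A ∪ B)).det = (schurBlock K C A A).det * (schurBlock K C B B).det ↔
      schurBlock K C A B = 0 := by
  have h := (hK.schurBlock (Finset.disjoint_union_left.mpr ⟨hAC, hBC⟩)).submatrix
    (Equiv.Finset.union A B hAB).injective
  rw [schurBlock_union K C hAB, ← conjTranspose_schurBlock hK.1 A B C] at h
  rw [← h.det_fromBlocks_eq_mul_iff_s10, conjTranspose_schurBlock hK.1 A B C,
    ← schurBlock_union K C hAB, det_submatrix_equiv_self]

/-- For a DPP with kernel `0 ≺ K ≺ I` and disjoint `A`, `B`, `C` with `C` nonempty,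
the events `A ⊆ Y` and `B ⊆ Y` are conditionally independent given `C ⊆ Y` iff
`K^C_{A,B} = 0`, i.e. `K_{A,B} = K_{A,C} K_C⁻¹ K_{C,B}`. -/
theorem dpp_cond_independent_iff {N : ℕ} (μ : Finset (Fin N) → ℝ)
    (K : Matrix (Fin N) (Fin N) ℝ) (hμ : IsDPP μ K) (hsymm : K.IsSymm)
    (hK : K.PosDef) (hKI : (1 - K).PosDef)
    (A B C : Finset (Fin N)) (hAB : Disjoint A B) (hAC : Disjoint A C)
    (hBC : Disjoint B C) (hCne : C.Nonempty) :
    pr μ (fun S => A ⊆ S ∧ B ⊆ S ∧ C ⊆ S) * pr μ (fun S => C ⊆ S)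
      = pr μ (fun S => A ⊆ S ∧ C ⊆ S) * pr μ (fun S => B ⊆ S ∧ C ⊆ S)
    ↔ schurBlock K C A B = 0 := by
  obtain ⟨-, -, hdet⟩ := hμ
  simp only [← Finset.union_subset_iff, hdet, ← Finset.union_assoc]
  rw [det_subm_union_eq_mul_schurBlock hK (Finset.disjoint_union_left.mpr ⟨hAC, hBC⟩),
    det_subm_union_eq_mul_schurBlock hK hAC, det_subm_union_eq_mul_schurBlock hK hBC,
    ← det_schurBlock_union_eq_mul_iff hK hAB hAC hBC]
  have hC : (subm K C C).det ≠ 0 := (hK.subm C).det_pos.ne'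
  constructor
  · intro h
    exact mul_left_cancel₀ (mul_ne_zero hC hC) (by linear_combination h)
  · intro h
    rw [h]; ring
end

section
/- Let μ be a determinantal point process over 𝒴 = Fin N with real symmetric kernel K satisfying 0 ≺ K ≺ I, and let i ≠ j be elements of 𝒴. Then the processes Y ∩ {i} and Y ∩ {j} are conditionally independent given the event (𝒴 \ {i,j} ⊆ Y) — i.e. for all A₁ ⊆ {i} and B₁ ⊆ {j}, Pr(Y ∩ {i} = A₁ and Y ∩ {j} = B₁ and 𝒴\{i,j} ⊆ Y)·Pr(𝒴\{i,j} ⊆ Y) = Pr(Y ∩ {i} = A₁ and 𝒴\{i,j} ⊆ Y)·Pr(Y ∩ {j} = B₁ and 𝒴\{i,j} ⊆ Y) — if and only if (K⁻¹)_{i j} = 0. -/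
open Matrix BigOperators

theorem det_eq_det_subm_mul_det_subm_compl {N : ℕ} (M : Matrix (Fin N) (Fin N) ℝ)
    (A : Finset (Fin N)) (h : ∀ a ∉ A, ∀ b ∈ A, M a b = 0) :
    M.det = (subm M A A).det * (subm M Aᶜ Aᶜ).det := by
  rw [Matrix.twoBlockTriangular_det M (fun a => a ∈ A) h]
  congr 1
  · have hA : M.toSquareBlockProp (fun a => a ∈ A) = subm M A A := rfl
    rw [← hA]
    congr!
  · rw [← Matrix.det_submatrix_equiv_self
      (Equiv.subtypeEquivRight (fun a => (Finset.mem_compl (s := A) (a := a))))]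
    rfl

theorem subm_one {N : ℕ} (A : Finset (Fin N)) :
    subm (1 : Matrix (Fin N) (Fin N) ℝ) A A = 1 := by
  ext a b
  simp only [subm, Matrix.one_apply, Subtype.ext_iff]

/-- Jacobi's complementary minor formula for principal minors. -/
theorem det_subm_eq_det_mul_det_subm_inv_compl {N : ℕ} (K : Matrix (Fin N) (Fin N) ℝ)
    (hK : IsUnit K.det) (A : Finset (Fin N)) :
    (subm K A A).det = K.det * (subm K⁻¹ Aᶜ Aᶜ).det := by
  obtain ⟨R, hR⟩ : ∃ R : Matrix (Fin N) (Fin N) ℝ, ∀ a b, R a b =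
      if b ∈ A then (1 : Matrix (Fin N) (Fin N) ℝ) a b else K⁻¹ a b :=
    ⟨fun _ _ => _, fun _ _ => rfl⟩
  have hKR : ∀ a b, (K * R) a b =
      if b ∈ A then K a b else (1 : Matrix (Fin N) (Fin N) ℝ) a b := by
    intro a b
    by_cases hb : b ∈ A
    · simp [Matrix.mul_apply, hR, hb, Matrix.one_apply]
    · simp only [hb, if_false, ← Matrix.mul_nonsing_inv K hK, Matrix.mul_apply, hR]
  have hRA : subm R A A = 1 := by
    rw [← subm_one]
    ext a b
    simp only [subm, hR, if_pos b.2]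
  have hRAc : subm R Aᶜ Aᶜ = subm K⁻¹ Aᶜ Aᶜ := by
    ext a b
    simp only [subm, hR, if_neg (Finset.mem_compl.1 b.2)]
  have hKRA : subm (K * R) A A = subm K A A := by
    ext a b
    simp only [subm, hKR, if_pos b.2]
  have hKRAc : subm (K * R) Aᶜ Aᶜ = 1 := by
    rw [← subm_one]
    ext a b
    simp only [subm, hKR, if_neg (Finset.mem_compl.1 b.2)]
  have hdetR : R.det = (subm K⁻¹ Aᶜ Aᶜ).det := by
    rw [det_eq_det_subm_mul_det_subm_compl R A, hRA, hRAc, Matrix.det_one, one_mul]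
    intro a ha b hb
    rw [hR, if_pos hb, Matrix.one_apply_ne (ne_of_mem_of_not_mem hb ha).symm]
  have hdetKR : (K * R).det = (subm K A A).det := by
    rw [← Matrix.det_transpose, det_eq_det_subm_mul_det_subm_compl (K * R)ᵀ A]
    · change (subm (K * R) A A)ᵀ.det * (subm (K * R) Aᶜ Aᶜ)ᵀ.det = _
      rw [Matrix.det_transpose, Matrix.det_transpose, hKRA, hKRAc, Matrix.det_one, mul_one]
    · intro a ha b hb
      rw [Matrix.transpose_apply, hKR, if_neg ha, Matrix.one_apply_ne (ne_of_mem_of_not_mem hb ha)]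
  rw [← hdetKR, Matrix.det_mul, hdetR]

theorem det_subm_singleton {N : ℕ} (X : Matrix (Fin N) (Fin N) ℝ) (i : Fin N) :
    (subm X {i} {i}).det = X i i := by
  rw [Matrix.det_unique]
  rfl

theorem det_subm_pair {N : ℕ} (X : Matrix (Fin N) (Fin N) ℝ) {i j : Fin N} (hij : i ≠ j) :
    (subm X {i, j} {i, j}).det = X i i * X j j - X i j * X j i := by
  let f : Fin 2 → ({i, j} : Finset (Fin N)) := ![⟨i, by simp⟩, ⟨j, by simp⟩]
  have hf : Function.Bijective f := by
    constructor
    · intro a b hab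
      fin_cases a <;> fin_cases b <;> simp_all [f, Subtype.ext_iff, hij.symm]
    · rintro ⟨a, ha⟩
      rcases Finset.mem_insert.1 ha with rfl | ha'
      · exact ⟨0, rfl⟩
      · obtain rfl := Finset.mem_singleton.1 ha'
        exact ⟨1, rfl⟩
  rw [← Matrix.det_submatrix_equiv_self (Equiv.ofBijective f hf), Matrix.det_fin_two]
  rfl

theorem pr_congr {N : ℕ} (μ : Finset (Fin N) → ℝ) {E F : Finset (Fin N) → Prop}
    (h : ∀ S, E S ↔ F S) : pr μ E = pr μ F := by
  rw [funext fun S => propext (h S)]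

theorem pr_not_and {N : ℕ} (μ : Finset (Fin N) → ℝ) (E F : Finset (Fin N) → Prop) :
    pr μ (fun S => ¬ E S ∧ F S) = pr μ F - pr μ (fun S => E S ∧ F S) := by
  unfold pr
  rw [← Finset.sum_sub_distrib]
  refine Finset.sum_congr rfl fun S _ => ?_
  by_cases hE : E S <;> by_cases hF : F S <;> simp [hE, hF]

theorem inter_singleton_eq_singleton {N : ℕ} (S : Finset (Fin N)) (i : Fin N) :
    S ∩ {i} = {i} ↔ i ∈ S := by
  simp

theorem inter_singleton_eq_empty {N : ℕ} (S : Finset (Fin N)) (i : Fin N) :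
    S ∩ {i} = ∅ ↔ i ∉ S := by
  rw [← Finset.disjoint_iff_inter_eq_empty, Finset.disjoint_singleton_right]

/-- Conditional independence of `Y ∩ {i}` and `Y ∩ {j}` given an event `L` amounts to the product
formula for the two events `i ∈ Y` and `j ∈ Y`. -/
theorem singleton_cond_independent_iff {N : ℕ} (μ : Finset (Fin N) → ℝ)
    (L : Finset (Fin N) → Prop) (i j : Fin N) :
    (∀ A₁ ⊆ ({i} : Finset (Fin N)), ∀ B₁ ⊆ ({j} : Finset (Fin N)),
      pr μ (fun S => S ∩ {i} = A₁ ∧ S ∩ {j} = B₁ ∧ L S) * pr μ L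
        = pr μ (fun S => S ∩ {i} = A₁ ∧ L S) * pr μ (fun S => S ∩ {j} = B₁ ∧ L S))
    ↔ pr μ (fun S => i ∈ S ∧ j ∈ S ∧ L S) * pr μ L
        = pr μ (fun S => i ∈ S ∧ L S) * pr μ (fun S => j ∈ S ∧ L S) := by
  have hij : pr μ (fun S => i ∈ S ∧ j ∉ S ∧ L S)
      = pr μ (fun S => i ∈ S ∧ L S) - pr μ (fun S => i ∈ S ∧ j ∈ S ∧ L S) := by
    rw [pr_congr μ (fun S => and_left_comm), pr_not_and μ (fun S => j ∈ S)]
    simp only [and_left_comm]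
  constructor
  · intro h
    simpa only [inter_singleton_eq_singleton] using h {i} subset_rfl {j} subset_rfl
  · intro h A₁ hA B₁ hB
    rcases Finset.subset_singleton_iff.1 hA with rfl | rfl <;>
    rcases Finset.subset_singleton_iff.1 hB with rfl | rfl <;>
    simp only [inter_singleton_eq_singleton, inter_singleton_eq_empty,
      pr_not_and μ (fun S => i ∈ S), pr_not_and μ (fun S => j ∈ S), hij] <;>
    first | linear_combination h | linear_combination -h

/-- For a DPP with kernel `0 ≺ K ≺ I` and `i ≠ j`, the processes `Y ∩ {i}` and `Y ∩ {j}`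
are conditionally independent given `(Fin N \ {i,j}) ⊆ Y` iff `(K⁻¹)_{i j} = 0`. -/
theorem dpp_singleton_cond_independent_iff_inv {N : ℕ} (μ : Finset (Fin N) → ℝ)
    (K : Matrix (Fin N) (Fin N) ℝ) (hμ : IsDPP μ K) (hsymm : K.IsSymm)
    (hK : K.PosDef) (hKI : (1 - K).PosDef) (i j : Fin N) (hij : i ≠ j) :
    (∀ A₁ ⊆ ({i} : Finset (Fin N)), ∀ B₁ ⊆ ({j} : Finset (Fin N)),
      pr μ (fun S => S ∩ {i} = A₁ ∧ S ∩ {j} = B₁ ∧ Finset.univ \ {i, j} ⊆ S)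
          * pr μ (fun S => Finset.univ \ {i, j} ⊆ S)
        = pr μ (fun S => S ∩ {i} = A₁ ∧ Finset.univ \ {i, j} ⊆ S)
          * pr μ (fun S => S ∩ {j} = B₁ ∧ Finset.univ \ {i, j} ⊆ S))
    ↔ K⁻¹ i j = 0 := by
  have hdet : K.det ≠ 0 := hK.det_pos.ne'
  have hunit : IsUnit K.det := hdet.isUnit
  have hX : K⁻¹ j i = K⁻¹ i j := by
    rw [← Matrix.transpose_apply K⁻¹, Matrix.transpose_nonsing_inv, hsymm.eq]
  have hsub : ∀ A : Finset (Fin N),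
      pr μ (fun S => Aᶜ ⊆ S) = K.det * (subm K⁻¹ A A).det := by
    intro A
    rw [hμ.2.2, det_subm_eq_det_mul_det_subm_inv_compl K hunit, compl_compl]
  have hL : pr μ (fun S => Finset.univ \ {i, j} ⊆ S)
      = K.det * (K⁻¹ i i * K⁻¹ j j - K⁻¹ i j * K⁻¹ i j) := by
    rw [← Finset.compl_eq_univ_sdiff, hsub, det_subm_pair _ hij, hX]
  have hi : pr μ (fun S => i ∈ S ∧ Finset.univ \ {i, j} ⊆ S) = K.det * K⁻¹ j j := by
    rw [← det_subm_singleton K⁻¹ j, ← hsub]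
    refine pr_congr μ fun S => ?_
    simp only [Finset.subset_iff, Finset.mem_sdiff, Finset.mem_compl, Finset.mem_insert,
      Finset.mem_singleton, Finset.mem_univ, true_and]
    grind
  have hj : pr μ (fun S => j ∈ S ∧ Finset.univ \ {i, j} ⊆ S) = K.det * K⁻¹ i i := by
    rw [← det_subm_singleton K⁻¹ i, ← hsub]
    refine pr_congr μ fun S => ?_
    simp only [Finset.subset_iff, Finset.mem_sdiff, Finset.mem_compl, Finset.mem_insert,
      Finset.mem_singleton, Finset.mem_univ, true_and]
    grind
  have hall : pr μ (fun S => i ∈ S ∧ j ∈ S ∧ Finset.univ \ {i, j} ⊆ S) = K.det := by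
    have h := hsub ∅
    rw [Matrix.det_isEmpty (A := subm K⁻¹ ∅ ∅), mul_one] at h
    rw [← h]
    refine pr_congr μ fun S => ?_
    simp only [Finset.subset_iff, Finset.mem_sdiff, Finset.mem_compl, Finset.mem_insert,
      Finset.mem_singleton, Finset.mem_univ, true_and, Finset.notMem_empty, not_false_eq_true]
    grind
  rw [singleton_cond_independent_iff μ (fun S => Finset.univ \ {i, j} ⊆ S), hL, hi, hj, hall]
  constructor
  · intro h
    have h0 : K.det ^ 2 * K⁻¹ i j ^ 2 = 0 := by linear_combination -h
    simpa [hdet] using h0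
  · intro h
    rw [h]
    ring
end
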